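/- Fix y = (y₁,y₂,y₃) ∈ ℝ³ with y₃ > 0 and vectors g, ν ∈ ℝ³. Let vᵢ(x) = (1/4π) Σⱼ Σₖ [(xᵢ−yᵢ)/|x−y|³] δⱼₖ νₖ gⱼ − (1/4π) Σⱼ Σₖ [(xᵢ−yᴵᵢ)/|x−yᴵ|³] δⱼₖ νᴵₖ gᴵⱼ. Then for every x = (x₁,x₂,0) with x ≠ yᴵ, the tangential components vanish, v₁(x) = v₂(x) = 0, and the normal component is v₃(x) = −2 (νᴵ·gᴵ) Gᴰ[h](x,yᴵ), where h = (0,0,1). -/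

import Mathlib

open Real Finset

noncomputable section

/-- Points in three-dimensional Euclidean space. -/
abbrev E3 := EuclideanSpace ℝ (Fin 3)

/-- Partial derivative `∂f/∂xᵢ` of a scalar field on `ℝ³`. -/
def pd (i : Fin 3) (f : E3 → ℝ) (x : E3) : ℝ :=
  fderiv ℝ f x (EuclideanSpace.single i 1)

/-- Kronecker delta. -/
def kron (i j : Fin 3) : ℝ := if i = j then 1 else 0

/-- Reflected image point `yᴵ = (y₁, y₂, -y₃)`. -/
def reflPt (y : E3) : E3 := (EuclideanSpace.equiv (Fin 3) ℝ).symm ![y 0, y 1, -y 2]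

/-- Reflected vector `fᴵ = (f₁, f₂, -f₃)`. -/
def reflVec (f : Fin 3 → ℝ) : Fin 3 → ℝ := ![f 0, f 1, -f 2]

/-- Harmonic potential of a unit charge, `Gˢ(x,y) = 1/(4π|x-y|)`. -/
def GS (x y : E3) : ℝ := 1 / (4 * π * ‖x - y‖)

/-- Harmonic potential of a unit dipole with orientation `ν`:
`Gᴰ[ν](x,y) = Σᵢ νᵢ ∂/∂yᵢ Gˢ(x,y)`. -/
def GD (ν : Fin 3 → ℝ) (x y : E3) : ℝ := ∑ i, ν i * pd i (fun z => GS x z) y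

/-- Harmonic potential of a unit quadrupole with orientations `ν, κ`:
`G^Q[ν,κ](x,y) = Σᵢ Σⱼ νᵢ κⱼ ∂²/∂yᵢ∂yⱼ Gˢ(x,y)`. -/
def GQ (ν κ : Fin 3 → ℝ) (x y : E3) : ℝ :=
  ∑ i, ∑ j, ν i * κ j * pd i (fun z => pd j (fun w => GS x w) z) y

/-- The velocity induced by the kernel `(1/4π)(xᵢ-yᵢ)δⱼₖ/|x-y|³` minus its
reflected image. -/
def vP (y : E3) (g ν : Fin 3 → ℝ) (i : Fin 3) (x : E3) : ℝ :=
  (1 / (4 * π)) * (∑ j, ∑ k, (x i - y i) / ‖x - y‖ ^ 3 * kron j k * ν k * g j)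
    - (1 / (4 * π)) *
        ∑ j, ∑ k, (x i - reflPt y i) / ‖x - reflPt y‖ ^ 3 * kron j k * reflVec ν k * reflVec g j

/-- The gradient of the unit charge potential in its source point. -/
theorem pd_GS {x z : E3} (h : x ≠ z) (i : Fin 3) :
    pd i (fun w => GS x w) z = (x i - z i) / (4 * π * ‖x - z‖ ^ 3) := by
  have hn : ‖x - z‖ ≠ 0 := norm_ne_zero_iff.2 (sub_ne_zero.2 h)
  have hπ : π ≠ 0 := pi_ne_zero
  have hnorm := (((hasFDerivAt_id z).const_sub x).norm_sq).sqrt (pow_ne_zero 2 hn)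
  simp only [sqrt_sq (norm_nonneg _), id] at hnorm
  have hGS := (hasDerivAt_inv (mul_ne_zero (mul_ne_zero four_ne_zero hπ) hn)).comp_hasFDerivAt z
    (hnorm.const_mul (4 * π))
  have hfun : (fun w => GS x w) = Inv.inv ∘ fun w : E3 => 4 * π * ‖x - w‖ := by
    ext w
    simp [GS]
  rw [pd, hfun, hGS.fderiv]
  simp [EuclideanSpace.inner_single_right]
  field_simp
  ring

theorem norm_sub_reflPt {x : E3} (hx : x 2 = 0) (y : E3) : ‖x - reflPt y‖ = ‖x - y‖ := by
  rw [← sq_eq_sq₀ (norm_nonneg _) (norm_nonneg _)]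
  simp [EuclideanSpace.real_norm_sq_eq, Fin.sum_univ_three, reflPt, hx]

/-- on the plane `x₃ = 0` the tangential components of `v` vanish
and the normal component is `-2 (νᴵ·gᴵ) Gᴰ[h](x, yᴵ)` with `h = (0,0,1)`. -/
theorem pressure_term_image_boundary (y : E3) (hy : 0 < y 2) (g ν : Fin 3 → ℝ) :
    ∀ x : E3, x 2 = 0 → x ≠ reflPt y →
      vP y g ν 0 x = 0 ∧ vP y g ν 1 x = 0 ∧
      vP y g ν 2 x =
        -2 * (∑ i, reflVec ν i * reflVec g i) * GD ![(0 : ℝ), 0, 1] x (reflPt y) := by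
  intro x hx hne
  have hn : ‖x - y‖ ≠ 0 := by
    rw [← norm_sub_reflPt hx]
    exact norm_ne_zero_iff.2 (sub_ne_zero.2 hne)
  have hπ : π ≠ 0 := pi_ne_zero
  simp only [vP, GD, pd_GS hne, norm_sub_reflPt hx]
  refine ⟨?_, ?_, ?_⟩ <;> simp [Fin.sum_univ_three, kron, reflPt, reflVec, hx]
  field_simp
  ring
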